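/- arXiv:1806.00860 — 3 statements merged into one kernel-verified Lean document; each statement's English description precedes it below -/
import Mathlib

section
/- Let v : S → ℝ be a column vector with v^T 𝟙 = 0. Then a vector g : S → ℝ satisfies g^T (I − K) = v^T and g^T 𝟙 = 0 if and only if g^T = Σ_{s=0}^∞ v^T K^s (the series converging absolutely). -/
open Matrix Finset

/-- Equation (7.5): for a finite-state stochastic matrix `K` whose powers converge
geometrically to `𝟙 μᵀ`, and any vector `v` with `vᵀ 𝟙 = 0`, a vector `g` satisfies
`gᵀ (I − K) = vᵀ` and `gᵀ 𝟙 = 0` if and only if `gᵀ = ∑_{s=0}^∞ vᵀ K^s`, the series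
converging absolutely. -/
theorem poisson_row_vector_characterization
    {S : Type*} [Fintype S] [DecidableEq S] (K : Matrix S S ℝ)
    (hK0 : ∀ p q, 0 ≤ K p q) (hK1 : ∀ p, ∑ q, K p q = 1)
    (μ : S → ℝ) (hμ0 : ∀ p, 0 ≤ μ p) (hμ1 : ∑ p, μ p = 1) (hμK : μ ᵥ* K = μ)
    (C ρ : ℝ) (hC : 0 < C) (hρ0 : 0 < ρ) (hρ1 : ρ < 1)
    (hgeo : ∀ (s : ℕ) (p q : S), |(K ^ s) p q - μ q| ≤ C * ρ ^ s)
    (v : S → ℝ) (hv : ∑ p, v p = 0) (g : S → ℝ) :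
    (g ᵥ* (1 - K) = v ∧ ∑ p, g p = 0) ↔
      (∀ p, Summable (fun s : ℕ => |(v ᵥ* K ^ s) p|) ∧
        HasSum (fun s : ℕ => (v ᵥ* K ^ s) p) (g p)) := by
  have key : ∀ w : S → ℝ, ∑ p, w p = 0 → ∀ (p : S) (s : ℕ),
      |(w ᵥ* K ^ s) p| ≤ ((∑ i, |w i|) * C) * ρ ^ s := by
    intro w hw p s
    have h1 : (w ᵥ* K ^ s) p = ∑ i, w i * ((K ^ s) i p - μ p) := by
      simp only [mul_sub, Finset.sum_sub_distrib, ← Finset.sum_mul, hw, zero_mul, sub_zero]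
      rfl
    rw [h1]
    calc |∑ i, w i * ((K ^ s) i p - μ p)| ≤ ∑ i, |w i * ((K ^ s) i p - μ p)| :=
          Finset.abs_sum_le_sum_abs _ _
      _ ≤ ∑ i, |w i| * (C * ρ ^ s) := by
          refine Finset.sum_le_sum fun i _ => ?_
          rw [abs_mul]
          exact mul_le_mul_of_nonneg_left (hgeo s i p) (abs_nonneg _)
      _ = ((∑ i, |w i|) * C) * ρ ^ s := by rw [← Finset.sum_mul, mul_assoc]
  have hgs : ∀ c : ℝ, Summable (fun s : ℕ => c * ρ ^ s) := fun c =>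
    (summable_geometric_of_lt_one hρ0.le hρ1).mul_left c
  have habs : ∀ w : S → ℝ, ∑ p, w p = 0 → ∀ p : S,
      Summable (fun s : ℕ => |(w ᵥ* K ^ s) p|) := fun w hw p =>
    Summable.of_nonneg_of_le (fun s => abs_nonneg _) (key w hw p) (hgs _)
  have hstep : ∀ (w : S → ℝ) (s : ℕ), (w ᵥ* K ^ s) ᵥ* K = w ᵥ* K ^ (s + 1) := by
    intro w s
    rw [Matrix.vecMul_vecMul, pow_succ]
  constructor
  · rintro ⟨hg, hg0⟩ p
    refine ⟨habs v hv p, ?_⟩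
    rw [(habs v hv p).of_abs.hasSum_iff_tendsto_nat]
    have htel : ∀ n : ℕ, ∑ s ∈ Finset.range n, (v ᵥ* K ^ s) p = g p - (g ᵥ* K ^ n) p := by
      intro n
      induction n with
      | zero => simp
      | succ n ih =>
        have : v ᵥ* K ^ n = g ᵥ* K ^ n - g ᵥ* K ^ (n + 1) := by
          rw [← hg, Matrix.vecMul_vecMul, sub_mul, one_mul, ← pow_succ', Matrix.vecMul_sub]
        rw [Finset.sum_range_succ, ih, this, Pi.sub_apply]
        ring
    simp only [htel]
    simpa using (habs g hg0 p).of_abs.tendsto_atTop_zero.const_sub (g p)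
  · intro h
    have hsum : ∀ (w : S → ℝ), ∑ q, (w ᵥ* K) q = ∑ p, w p := by
      intro w
      simp only [Matrix.vecMul, dotProduct]
      rw [Finset.sum_comm]
      simp only [← Finset.mul_sum, hK1, mul_one]
    have hz : ∀ s : ℕ, ∑ p, (v ᵥ* K ^ s) p = 0 := by
      intro s
      induction s with
      | zero => simpa using hv
      | succ s ih => rw [← hstep, hsum, ih]
    constructor
    · funext q
      have h1 : HasSum (fun s : ℕ => (v ᵥ* K ^ (s + 1)) q) ((g ᵥ* K) q) := by
        have := hasSum_sum (s := Finset.univ)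
          (fun (p : S) _ => (h p).2.mul_right (K p q))
        simp only [← hstep]
        exact this
      have h2 := (hasSum_nat_add_iff' 1).2 (h q).2
      have h3 := h1.unique h2
      simp only [Finset.sum_range_one, pow_zero, Matrix.vecMul_one] at h3
      rw [Matrix.vecMul_sub, Matrix.vecMul_one, Pi.sub_apply, h3]
      ring
    · have h1 := hasSum_sum (s := Finset.univ) (fun (p : S) _ => (h p).2)
      simp only [hz] at h1
      exact h1.unique hasSum_zero
end

section
/- Let A be an S×S real matrix with A𝟙 = 0, and suppose ε ↦ m(ε) ∈ ℝ^S is defined on a neighborhood of 0, differentiable at 0, and satisfies m(0) = μ, m(ε)^T (K + εA) = m(ε)^T and m(ε)^T 𝟙 = 1 for all ε in that neighborhood. Then d/dε (m(ε)^T f)|_{ε=0} = μ^T A h. -/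
open Matrix Filter

/-- Lemma 7.2: let `K` be a finite-state stochastic matrix with stationary vector `μ` whose
powers converge geometrically to `𝟙 μᵀ`, let `h` be the Poisson solution for `f`, and let
`A` be a matrix with `A 𝟙 = 0`. If `ε ↦ m(ε)` is differentiable at `0`, `m(0) = μ`, and
`m(ε)ᵀ (K + εA) = m(ε)ᵀ`, `m(ε)ᵀ 𝟙 = 1` for all `ε` near `0`, then
`d/dε m(ε)ᵀ f |_{ε=0} = μᵀ A h`. -/
theorem stationary_sensitivity_derivative
    {S : Type*} [Fintype S] [DecidableEq S] (K : Matrix S S ℝ)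
    (hK0 : ∀ p q, 0 ≤ K p q) (hK1 : ∀ p, ∑ q, K p q = 1)
    (μ : S → ℝ) (hμ0 : ∀ p, 0 ≤ μ p) (hμ1 : ∑ p, μ p = 1) (hμK : μ ᵥ* K = μ)
    (C ρ : ℝ) (hC : 0 < C) (hρ0 : 0 < ρ) (hρ1 : ρ < 1)
    (hgeo : ∀ (s : ℕ) (p q : S), |(K ^ s) p q - μ q| ≤ C * ρ ^ s)
    (f h : S → ℝ)
    (hPoisson : (1 - K) *ᵥ h = f - (μ ⬝ᵥ f) • (1 : S → ℝ)) (hμh : μ ⬝ᵥ h = 0)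
    (A : Matrix S S ℝ) (hA : A *ᵥ (1 : S → ℝ) = 0)
    (m : ℝ → S → ℝ) (hdiff : DifferentiableAt ℝ m 0) (hm0 : m 0 = μ)
    (hstat : ∀ᶠ ε in nhds (0 : ℝ), m ε ᵥ* (K + ε • A) = m ε)
    (hnorm : ∀ᶠ ε in nhds (0 : ℝ), (m ε) ⬝ᵥ (1 : S → ℝ) = 1) :
    deriv (fun ε => m ε ⬝ᵥ f) 0 = (μ ᵥ* A) ⬝ᵥ h := by
  have hev : (fun ε => m ε ⬝ᵥ f) =ᶠ[nhds (0 : ℝ)]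
      (fun ε => ε * (m ε ⬝ᵥ (A *ᵥ h)) + μ ⬝ᵥ f) := by
    filter_upwards [hstat, hnorm] with ε h1 h2
    have hf : f = (1 - K) *ᵥ h + (μ ⬝ᵥ f) • (1 : S → ℝ) := by
      rw [hPoisson]; simp
    have h3 : m ε ⬝ᵥ h = m ε ⬝ᵥ (K *ᵥ h) + ε * (m ε ⬝ᵥ (A *ᵥ h)) := by
      conv_lhs => rw [← h1]
      rw [← dotProduct_mulVec, add_mulVec, dotProduct_add, smul_mulVec, dotProduct_smul,
        smul_eq_mul]
    have h4 : m ε ⬝ᵥ f = m ε ⬝ᵥ ((1 - K) *ᵥ h + (μ ⬝ᵥ f) • (1 : S → ℝ)) :=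
      congrArg (fun v => m ε ⬝ᵥ v) hf
    rw [h4, dotProduct_add, dotProduct_smul, h2, sub_mulVec, one_mulVec, dotProduct_sub, h3,
      smul_eq_mul]
    ring
  have hg : DifferentiableAt ℝ (fun ε => m ε ⬝ᵥ (A *ᵥ h)) 0 := by
    unfold dotProduct
    have := differentiableAt_pi.1 hdiff
    fun_prop
  rw [hev.deriv_eq]
  have hd := (((hasDerivAt_id (0 : ℝ)).mul hg.hasDerivAt).add_const (μ ⬝ᵥ f)).deriv
  rw [← dotProduct_mulVec]
  refine Eq.trans hd ?_
  simp [hm0]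
end

section
/- Residual resampling is unbiased and conserves the sample count: let I be a finite set, d : I → [0,1] with Σ_{i∈I} d_i = 1, and n a positive integer. Set δ_i = n d_i − ⌊n d_i⌋ and δ = Σ_{i∈I} δ_i (so δ = n − Σ_i ⌊n d_i⌋ is a nonnegative integer). If δ > 0, let (R_i)_{i∈I} be multinomially distributed with δ trials and event probabilities δ_i/δ; if δ = 0, set R_i = 0. Define N_i = ⌊n d_i⌋ + R_i. Then almost surely Σ_{i∈I} N_i = n, and E[N_i] = n d_i for every i ∈ I. -/
open MeasureTheory ProbabilityTheory Finset

/-- The residual `δ_i = n d_i − ⌊n d_i⌋` of residual resampling (Algorithm 5). -/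
noncomputable def resid {I : Type*} (n : ℕ) (d : I → ℝ) (i : I) : ℝ :=
  (n : ℝ) * d i - (⌊(n : ℝ) * d i⌋₊ : ℝ)

/-- First moment of the multinomial weights, by differentiating the multinomial theorem. -/
theorem multinomial_first_moment {I : Type*} [Fintype I] [DecidableEq I] (p : I → ℝ)
    (hp : ∑ i, p i = 1) (m : ℕ) (i : I) :
    ∑ r ∈ piAntidiag (univ : Finset I) m,
      (r i : ℝ) * ((Nat.multinomial univ r : ℝ) * ∏ j, p j ^ r j) = m * p i := by
  let x : ℝ → I → ℝ := fun t => Function.update p i t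
  have hprod : ∀ (t : ℝ) (r : I → ℕ),
      ∏ j, x t j ^ r j = t ^ r i * ∏ j ∈ univ.erase i, p j ^ r j := by
    intro t r
    rw [← Finset.mul_prod_erase univ _ (mem_univ i)]
    congr 1
    · simp [x]
    · apply Finset.prod_congr rfl
      intro j hj
      simp [x, Function.update_of_ne (ne_of_mem_erase hj)]
  have hsum : ∀ t : ℝ, ∑ j, x t j = t + ∑ j ∈ univ.erase i, p j := by
    intro t
    rw [← Finset.add_sum_erase univ _ (mem_univ i)]
    congr 1
    · simp [x]
    · apply Finset.sum_congr rfl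
      intro j hj
      simp [x, Function.update_of_ne (ne_of_mem_erase hj)]
  have hp' : p i + ∑ j ∈ univ.erase i, p j = 1 := by
    rw [Finset.add_sum_erase univ _ (mem_univ i), hp]
  have hfun : (fun t : ℝ => (t + ∑ j ∈ univ.erase i, p j) ^ m) = fun t =>
      ∑ r ∈ piAntidiag (univ : Finset I) m, (Nat.multinomial univ r : ℝ) *
        (t ^ r i * ∏ j ∈ univ.erase i, p j ^ r j) := by
    funext t
    rw [← hsum, Finset.sum_pow_eq_sum_piAntidiag]
    simp only [hprod]
  have h1 : HasDerivAt (fun t : ℝ => (t + ∑ j ∈ univ.erase i, p j) ^ m) (m : ℝ) (p i) := by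
    have := ((hasDerivAt_id (p i)).add_const (∑ j ∈ univ.erase i, p j)).fun_pow m
    simp only [id, hp', one_pow, mul_one] at this
    exact this
  have h2 : HasDerivAt (fun t : ℝ =>
      ∑ r ∈ piAntidiag (univ : Finset I) m, (Nat.multinomial univ r : ℝ) *
        (t ^ r i * ∏ j ∈ univ.erase i, p j ^ r j))
      (∑ r ∈ piAntidiag (univ : Finset I) m, (Nat.multinomial univ r : ℝ) *
        (((r i : ℝ) * p i ^ (r i - 1)) * ∏ j ∈ univ.erase i, p j ^ r j)) (p i) := by
    apply HasDerivAt.fun_sum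
    intro r _
    exact ((hasDerivAt_pow (r i) (p i)).mul_const _).const_mul _
  rw [hfun] at h1
  rw [h1.unique h2, Finset.sum_mul]
  apply Finset.sum_congr rfl
  intro r _
  rw [← Finset.mul_prod_erase univ (fun j => p j ^ r j) (mem_univ i)]
  rcases Nat.eq_zero_or_pos (r i) with h | h
  · simp [h]
  · obtain ⟨k, hk⟩ : ∃ k, r i = k + 1 := ⟨r i - 1, by omega⟩
    simp only [hk, Nat.add_sub_cancel]
    ring

/-- Residual resampling (Algorithm 5) is unbiased and conserves the sample count:
with `δ_i = n d_i − ⌊n d_i⌋` and `δ = ∑_i δ_i` (so `δ = n − ∑_i ⌊n d_i⌋` is a nonnegative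
integer), if `(R_i)` is multinomial with `δ` trials and probabilities `δ_i/δ` (and `R_i = 0`
when `δ = 0`), then the counts `N_i = ⌊n d_i⌋ + R_i` satisfy `∑_i N_i = n` almost surely
and `E[N_i] = n d_i` for every `i`. -/
theorem residual_resampling_unbiased
    {I : Type*} [Fintype I] (d : I → ℝ) (hd0 : ∀ i, 0 ≤ d i) (hd1 : ∀ i, d i ≤ 1)
    (hdsum : ∑ i, d i = 1) (n : ℕ) (hn : 0 < n)
    {Ω : Type*} [MeasurableSpace Ω] (P : Measure Ω) [IsProbabilityMeasure P]
    (R : I → Ω → ℕ) (hRmeas : ∀ i, Measurable (R i))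
    -- if `δ = 0` there are no residual samples
    (hzero : (∑ i, resid n d i) = 0 → ∀ᵐ ω ∂P, ∀ i, R i ω = 0)
    -- if `δ > 0`, `(R_i)` is multinomial with `δ` trials and event probabilities `δ_i/δ`
    (hmult : 0 < ∑ i, resid n d i → ∀ r : I → ℕ,
      P {ω | ∀ i, R i ω = r i} =
        if (∑ i, r i) = n - ∑ i, ⌊(n : ℝ) * d i⌋₊ then
          ENNReal.ofReal
            (((n - ∑ i, ⌊(n : ℝ) * d i⌋₊).factorial : ℝ) / (∏ i, ((r i).factorial : ℝ)) *
              ∏ i, (resid n d i / ∑ j, resid n d j) ^ r i)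
        else 0) :
    (∃ m : ℕ, (∑ i, resid n d i) = (m : ℝ)) ∧
    (∑ i, resid n d i) = (n : ℝ) - ∑ i, (⌊(n : ℝ) * d i⌋₊ : ℝ) ∧
    (∀ᵐ ω ∂P, ∑ i, (⌊(n : ℝ) * d i⌋₊ + R i ω) = n) ∧
    ∀ i, ∫ ω, ((⌊(n : ℝ) * d i⌋₊ + R i ω : ℕ) : ℝ) ∂P = (n : ℝ) * d i := by
  classical
  have hδ : (∑ i, resid n d i) = (n : ℝ) - ∑ i, (⌊(n : ℝ) * d i⌋₊ : ℝ) := by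
    simp only [resid, Finset.sum_sub_distrib, ← Finset.mul_sum, hdsum, mul_one]
  have hres : ∀ i, 0 ≤ resid n d i := fun i =>
    sub_nonneg.2 (Nat.floor_le (mul_nonneg (Nat.cast_nonneg n) (hd0 i)))
  have hδ0 : 0 ≤ ∑ i, resid n d i := Finset.sum_nonneg fun i _ => hres i
  have hle : ∑ i, ⌊(n : ℝ) * d i⌋₊ ≤ n := by
    have : ((∑ i, ⌊(n : ℝ) * d i⌋₊ : ℕ) : ℝ) ≤ n := by push_cast; linarith
    exact_mod_cast this
  obtain ⟨m, hm⟩ : ∃ m, m = n - ∑ i, ⌊(n : ℝ) * d i⌋₊ := ⟨_, rfl⟩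
  have hδm : (∑ i, resid n d i) = (m : ℝ) := by
    rw [hδ, hm, Nat.cast_sub hle]; push_cast; rfl
  rw [← hm] at hmult
  refine ⟨⟨m, hδm⟩, hδ, ?_⟩
  -- it suffices to know the residual counts
  suffices h : (∀ᵐ ω ∂P, ∑ i, R i ω = m) ∧
      ∀ i, Integrable (fun ω => (R i ω : ℝ)) P ∧ ∫ ω, (R i ω : ℝ) ∂P = resid n d i by
    refine ⟨?_, fun i => ?_⟩
    · filter_upwards [h.1] with ω hω
      rw [Finset.sum_add_distrib, hω]; omega
    · push_cast
      rw [integral_add (integrable_const _) (h.2 i).1, (h.2 i).2]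
      simp [resid]
  rcases hδ0.eq_or_lt with h0 | hpos
  · have hz := hzero h0.symm
    have hm0 : m = 0 := by
      have : (m : ℝ) = 0 := by rw [← hδm, ← h0]
      exact_mod_cast this
    refine ⟨?_, fun i => ?_⟩
    · filter_upwards [hz] with ω hω
      simp [hω, hm0]
    · have hae : (fun ω => (R i ω : ℝ)) =ᵐ[P] fun _ => (0 : ℝ) := by
        filter_upwards [hz] with ω hω
        simp [hω]
      refine ⟨(integrable_const (0 : ℝ)).congr hae.symm, ?_⟩
      rw [integral_congr_ae hae]
      have := (Finset.sum_eq_zero_iff_of_nonneg fun i _ => hres i).1 h0.symm i (mem_univ i)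
      simp [this]
  · replace hmult := hmult hpos
    have hmeas : ∀ r : I → ℕ, MeasurableSet {ω | ∀ i, R i ω = r i} := by
      intro r
      rw [Set.ofPred_forall]
      exact MeasurableSet.iInter fun i => hRmeas i (measurableSet_singleton (r i))
    have has : ∀ᵐ ω ∂P, ∑ i, R i ω = m := by
      have h : ∀ᵐ ω ∂P, ∀ r : I → ℕ, ∑ i, r i ≠ m → ¬ ∀ i, R i ω = r i := by
        rw [ae_all_iff]
        intro r
        by_cases hr : ∑ i, r i = m
        · simp [hr]
        · have := hmult r
          rw [if_neg hr] at this
          rw [ae_iff]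
          simpa [hr] using this
      filter_upwards [h] with ω hω
      by_contra hc
      exact hω (fun i => R i ω) hc fun _ => rfl
    refine ⟨has, fun i => ?_⟩
    set δ := ∑ i, resid n d i with hδdef
    have hae : (fun ω => (R i ω : ℝ)) =ᵐ[P] fun ω =>
        ∑ r ∈ piAntidiag (univ : Finset I) m,
          Set.indicator {ω | ∀ i, R i ω = r i} (fun _ => (r i : ℝ)) ω := by
      filter_upwards [has] with ω hω
      rw [Finset.sum_eq_single (fun j => R j ω)]
      · simp
      · intro r _ hr
        rw [Set.indicator_of_notMem]
        intro hc
        exact hr (funext fun j => (hc j).symm)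
      · intro hc
        exact absurd (by simp [hω]) hc
    have hint : ∀ r ∈ piAntidiag (univ : Finset I) m, Integrable
        (Set.indicator {ω | ∀ i, R i ω = r i} (fun _ => (r i : ℝ))) P :=
      fun r _ => (integrable_const _).indicator (hmeas r)
    refine ⟨(integrable_finsetSum _ hint).congr hae.symm, ?_⟩
    rw [integral_congr_ae hae, integral_finsetSum _ hint]
    have hp : ∑ j, resid n d j / δ = 1 := by
      rw [← Finset.sum_div, ← hδdef, div_self hpos.ne']
    have key := multinomial_first_moment (fun j => resid n d j / δ) hp m i
    have hfin : (m : ℝ) * (resid n d i / δ) = resid n d i := by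
      rw [← hδm]; field_simp
    rw [← hfin, ← key]
    apply Finset.sum_congr rfl
    intro r hr
    have hr' : ∑ j, r j = m := by simpa using hr
    rw [integral_indicator (hmeas r), setIntegral_const, smul_eq_mul, mul_comm]
    congr 1
    rw [measureReal_def, hmult r, if_pos hr', ENNReal.toReal_ofReal]
    · congr 1
      have hspec := Nat.multinomial_spec univ r
      rw [hr'] at hspec
      rw [← hspec]
      push_cast
      have : (∏ j, ((r j).factorial : ℝ)) ≠ 0 :=
        Finset.prod_ne_zero_iff.2 fun j _ => by exact_mod_cast (r j).factorial_ne_zero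
      field_simp
    · have : ∀ j, 0 ≤ resid n d j / δ := fun j => div_nonneg (hres j) hpos.le
      exact mul_nonneg (by positivity) (Finset.prod_nonneg fun j _ => pow_nonneg (this j) _)
end
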